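/- Let E and F be finite-dimensional real inner product spaces, and let α, β, ε₁, ε₂, η, ν be real numbers with 0 < α ≤ β, ε₁ ≥ 0, ε₂ ≥ 0, 0 < η ≤ 1/(2β²), and ν > 0. Let (r_t) be a sequence in F with ‖r₀‖ > 0 and, for each t, let J̄_t, J_t, E_{1,t}, E_{2,t} : E →L[ℝ] F be continuous linear maps such that r_{t+1} = r_t − η ((J̄_t + E_{2,t}) ∘ (J_t + E_{1,t})*) r_t, ‖J̄_t‖ ≤ β, ‖J_t‖ ≤ β, ‖E_{1,t}‖ ≤ ε₁, ‖E_{2,t}‖ ≤ ε₂, ⟪r_t, (J̄_t ∘ J_t*) r_t⟫ ≥ (1/2)·‖J_t* r_t‖², and ‖J_t* r_t‖ ≥ α·‖r_t‖. Set q = √(1 − η α²/2) + η·(β ε₁ + β ε₂ + ε₁ ε₂) and assume q < 1. Then for every natural number T with (T : ℝ) ≥ log(‖r₀‖/ν) / log(1/q), one has ‖r_T‖ ≤ ν. -/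

import Mathlib

open scoped RealInnerProductSpace

section ResidualContraction

variable {E F : Type*} [NormedAddCommGroup E] [InnerProductSpace ℝ E]
  [NormedAddCommGroup F] [InnerProductSpace ℝ F]

/-- An exact step `r ↦ r - η • A w` contracts when `w` is large and `A w` is positively
correlated with `r`. -/
lemma norm_sub_smul_apply_le_sqrt_mul {α β η : ℝ} (hα : 0 ≤ α) (hη0 : 0 ≤ η)
    (hη : η * β ^ 2 ≤ 1 / 2) (A : E →L[ℝ] F) (hA : ‖A‖ ≤ β) (r : F) (w : E)
    (hquad : (1 / 2) * ‖w‖ ^ 2 ≤ ⟪r, A w⟫) (hlow : α * ‖r‖ ≤ ‖w‖) :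
    ‖r - η • A w‖ ≤ Real.sqrt (1 - η * α ^ 2 / 2) * ‖r‖ := by
  have hAw : ‖A w‖ ^ 2 ≤ β ^ 2 * ‖w‖ ^ 2 := by
    rw [← mul_pow]
    exact pow_le_pow_left₀ (norm_nonneg _) (A.le_of_opNorm_le hA w) 2
  have hw : α ^ 2 * ‖r‖ ^ 2 ≤ ‖w‖ ^ 2 := by
    rw [← mul_pow]
    exact pow_le_pow_left₀ (by positivity) hlow 2
  have key : ‖r - η • A w‖ ^ 2 ≤ (1 - η * α ^ 2 / 2) * ‖r‖ ^ 2 := by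
    rw [norm_sub_sq_real, inner_smul_right, norm_smul, mul_pow, Real.norm_eq_abs, sq_abs]
    have h₁ := mul_le_mul_of_nonneg_left hquad hη0
    have h₂ := mul_le_mul_of_nonneg_left hAw (sq_nonneg η)
    have h₃ := mul_le_mul_of_nonneg_left hη (mul_nonneg hη0 (sq_nonneg ‖w‖))
    have h₄ := mul_le_mul_of_nonneg_left hw hη0
    linarith
  rw [← Real.sqrt_sq (norm_nonneg r), ← Real.sqrt_mul' _ (sq_nonneg _)]
  exact Real.le_sqrt_of_sq_le key

lemma norm_perturbed_comp_adjoint_sub_le [CompleteSpace E] [CompleteSpace F]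
    {β ε₁ ε₂ : ℝ} {A B E₁ E₂ : E →L[ℝ] F} (hA : ‖A‖ ≤ β) (hB : ‖B‖ ≤ β)
    (hE₁ : ‖E₁‖ ≤ ε₁) (hE₂ : ‖E₂‖ ≤ ε₂) :
    ‖(A + E₂).comp (ContinuousLinearMap.adjoint (B + E₁)) -
        A.comp (ContinuousLinearMap.adjoint B)‖ ≤ β * ε₁ + β * ε₂ + ε₁ * ε₂ := by
  have comp_le {C D : E →L[ℝ] F} {c d : ℝ} (hC : ‖C‖ ≤ c) (hD : ‖D‖ ≤ d) :
      ‖C.comp (ContinuousLinearMap.adjoint D)‖ ≤ c * d :=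
    (C.opNorm_comp_le _).trans <| mul_le_mul hC
      ((LinearIsometryEquiv.norm_map _ D).trans_le hD) (norm_nonneg _)
      ((norm_nonneg _).trans hC)
  have expand : (A + E₂).comp (ContinuousLinearMap.adjoint (B + E₁)) -
        A.comp (ContinuousLinearMap.adjoint B) =
      A.comp (ContinuousLinearMap.adjoint E₁) + E₂.comp (ContinuousLinearMap.adjoint B) +
        E₂.comp (ContinuousLinearMap.adjoint E₁) := by
    rw [map_add, ContinuousLinearMap.add_comp, ContinuousLinearMap.comp_add,
      ContinuousLinearMap.comp_add]
    abel
  rw [expand]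
  refine norm_add₃_le.trans ?_
  linarith [comp_le hA hE₁, comp_le hE₂ hB, comp_le hE₂ hE₁]

end ResidualContraction

lemma pow_mul_le_of_log_div_le {q a ν : ℝ} (hq0 : 0 < q) (hq1 : q < 1) (ha : 0 < a)
    (hν : 0 < ν) {T : ℕ} (hT : Real.log (a / ν) / Real.log (1 / q) ≤ T) :
    q ^ T * a ≤ ν := by
  have hlog : 0 < Real.log (1 / q) := Real.log_pos (by rwa [lt_div_iff₀ hq0, one_mul])
  rw [div_le_iff₀ hlog, ← Real.log_pow,
    Real.log_le_log_iff (by positivity) (by positivity), one_div, inv_pow,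
    div_le_iff₀ hν, inv_mul_eq_div, le_div_iff₀ (by positivity)] at hT
  linarith

/-- Main guarantee under instance noise: with per-step contraction factor
`q = √(1 − ηα²/2) + η(βε₁ + βε₂ + ε₁ε₂) < 1`, after
`T ≥ log(‖r₀‖/ν) / log(1/q)` iterations the residual is at most `ν`. -/
theorem stmt_15
    {E F : Type*} [NormedAddCommGroup E] [InnerProductSpace ℝ E] [FiniteDimensional ℝ E]
    [NormedAddCommGroup F] [InnerProductSpace ℝ F] [FiniteDimensional ℝ F]
    (α β ε₁ ε₂ η ν : ℝ) (hα : 0 < α) (hαβ : α ≤ β) (hε₁ : 0 ≤ ε₁) (hε₂ : 0 ≤ ε₂)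
    (hη0 : 0 < η) (hη : η ≤ 1 / (2 * β ^ 2)) (hν : 0 < ν)
    (r : ℕ → F) (hr0 : 0 < ‖r 0‖) (Jbar J E₁ E₂ : ℕ → (E →L[ℝ] F))
    (hrec : ∀ t : ℕ, r (t + 1) =
        r t - η • ((Jbar t + E₂ t).comp
          (ContinuousLinearMap.adjoint (J t + E₁ t))) (r t))
    (hJbar : ∀ t, ‖Jbar t‖ ≤ β) (hJ : ∀ t, ‖J t‖ ≤ β)
    (hE₁ : ∀ t, ‖E₁ t‖ ≤ ε₁) (hE₂ : ∀ t, ‖E₂ t‖ ≤ ε₂)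
    (hquad : ∀ t, (1/2) * ‖ContinuousLinearMap.adjoint (J t) (r t)‖ ^ 2 ≤
        ⟪r t, ((Jbar t).comp (ContinuousLinearMap.adjoint (J t))) (r t)⟫)
    (hlow : ∀ t, α * ‖r t‖ ≤ ‖ContinuousLinearMap.adjoint (J t) (r t)‖)
    (q : ℝ)
    (hq : q = Real.sqrt (1 - η * α ^ 2 / 2) + η * (β * ε₁ + β * ε₂ + ε₁ * ε₂))
    (hq1 : q < 1)
    (T : ℕ) (hT : Real.log (‖r 0‖ / ν) / Real.log (1 / q) ≤ (T : ℝ)) :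
    ‖r T‖ ≤ ν := by
  have hβ : 0 < β := hα.trans_le hαβ
  have hηβ : η * β ^ 2 ≤ 1 / 2 := by
    rw [le_div_iff₀ (by positivity)] at hη
    linarith
  have hηα : η * α ^ 2 ≤ 1 / 2 := le_trans (by gcongr) hηβ
  have hq0 : 0 < q := by
    have : 0 < Real.sqrt (1 - η * α ^ 2 / 2) := Real.sqrt_pos.2 (by linarith)
    rw [hq]
    positivity
  have step (t : ℕ) : ‖r (t + 1)‖ ≤ q * ‖r t‖ := by
    have hexact := norm_sub_smul_apply_le_sqrt_mul hα.le hη0.le hηβ (Jbar t) (hJbar t)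
      (r t) _ (hquad t) (hlow t)
    have hpert := ContinuousLinearMap.le_of_opNorm_le _
      (norm_perturbed_comp_adjoint_sub_le (hJbar t) (hJ t) (hE₁ t) (hE₂ t)) (r t)
    have hsplit : r (t + 1) =
        (r t - η • Jbar t (ContinuousLinearMap.adjoint (J t) (r t))) -
          η • ((Jbar t + E₂ t).comp (ContinuousLinearMap.adjoint (J t + E₁ t)) -
            (Jbar t).comp (ContinuousLinearMap.adjoint (J t))) (r t) := by
      rw [hrec t, sub_apply, smul_sub,
        ContinuousLinearMap.comp_apply (Jbar t)]
      abel
    rw [hsplit, hq]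
    refine (norm_sub_le _ _).trans ?_
    rw [norm_smul, Real.norm_of_nonneg hη0.le]
    linarith [mul_le_mul_of_nonneg_left hpert hη0.le]
  have hpow (t : ℕ) : ‖r t‖ ≤ q ^ t * ‖r 0‖ := by
    induction t with
    | zero => simp
    | succ t ih =>
      rw [pow_succ', mul_assoc]
      exact (step t).trans (mul_le_mul_of_nonneg_left ih hq0.le)
  exact (hpow T).trans (pow_mul_le_of_log_div_le hq0 hq1 hr0 hν hT)
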